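/- arXiv:1810.10249 — 5 statements merged into one kernel-verified Lean document; each statement's English description precedes it below -/
import Mathlib

section
/- For every integer N ≥ 2, the constant q_N := Σ_{i≥N} (1/i³ + N/(i²(i+1))) satisfies the estimate 1/N³ + 1/(2N(N+1)) + 1/(2N) < q_N < 1/(2N(N−1)) + 1/N − 1/(2N+1). -/
open MeasureTheory Set Filter

/-- `q_N = ∑_{i ≥ N} (1/i³ + N/(i²(i+1)))`, written as a sum over `i = j + N`, `j : ℕ`. -/
noncomputable def qConst (N : ℕ) : ℝ :=
  ∑' j : ℕ, (1 / (((j + N : ℕ) : ℝ)) ^ 3 +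
    (N : ℝ) / ((((j + N : ℕ) : ℝ)) ^ 2 * (((j + N : ℕ) : ℝ) + 1)))

lemma aux_u1 (x : ℝ) (hx : 2 ≤ x) :
    1 / x ^ 3 ≤ 1 / (2 * x * (x - 1)) - 1 / (2 * (x + 1) * (x + 1 - 1)) := by
  obtain ⟨y, rfl⟩ : ∃ y, x = y + 2 := ⟨x - 2, by ring⟩
  have hy : 0 ≤ y := by linarith
  rw [show y + 2 - 1 = y + 1 by ring, show y + 2 + 1 - 1 = y + 2 by ring, ← sub_nonneg]
  have : 1 / (2 * (y + 2) * (y + 1)) - 1 / (2 * (y + 2 + 1) * (y + 2)) - 1 / (y + 2) ^ 3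
      = 1 / ((y + 1) * (y + 2) ^ 3 * (y + 3)) := by
    rw [show y + 2 + 1 = y + 3 by ring]
    field_simp
    ring
  rw [this]; positivity

lemma aux_u2 (x : ℝ) (hx : 2 ≤ x) :
    1 / (x ^ 2 * (x + 1)) ≤ (1 / (2 * x ^ 2) + 1 / (6 * x ^ 3))
      - (1 / (2 * (x + 1) ^ 2) + 1 / (6 * (x + 1) ^ 3)) := by
  rw [← sub_nonneg]
  have : (1 / (2 * x ^ 2) + 1 / (6 * x ^ 3))
      - (1 / (2 * (x + 1) ^ 2) + 1 / (6 * (x + 1) ^ 3)) - 1 / (x ^ 2 * (x + 1))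
      = 1 / (6 * x ^ 3 * (x + 1) ^ 3) := by
    field_simp
    ring
  rw [this]; positivity

lemma aux_l1 (x : ℝ) (hx : 2 ≤ x) :
    (1 / (2 * x ^ 2) + 1 / (2 * x ^ 3))
      - (1 / (2 * (x + 1) ^ 2) + 1 / (2 * (x + 1) ^ 3)) ≤ 1 / x ^ 3 := by
  rw [← sub_nonneg]
  have : 1 / x ^ 3 - ((1 / (2 * x ^ 2) + 1 / (2 * x ^ 3))
      - (1 / (2 * (x + 1) ^ 2) + 1 / (2 * (x + 1) ^ 3)))
      = (2 * x + 1) / (2 * x ^ 3 * (x + 1) ^ 3) := by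
    field_simp
    ring
  rw [this]; positivity

lemma aux_l2 (x : ℝ) (hx : 2 ≤ x) :
    (1 / (2 * x ^ 2) + 1 / (8 * x ^ 3))
      - (1 / (2 * (x + 1) ^ 2) + 1 / (8 * (x + 1) ^ 3)) ≤ 1 / (x ^ 2 * (x + 1)) := by
  rw [← sub_nonneg]
  have : 1 / (x ^ 2 * (x + 1)) - ((1 / (2 * x ^ 2) + 1 / (8 * x ^ 3))
      - (1 / (2 * (x + 1) ^ 2) + 1 / (8 * (x + 1) ^ 3)))
      = (x ^ 2 + x - 1) / (8 * x ^ 3 * (x + 1) ^ 3) := by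
    field_simp
    ring
  rw [this]
  have : 0 ≤ x ^ 2 + x - 1 := by nlinarith
  positivity

theorem qConst_estimate (N : ℕ) (hN : 2 ≤ N) :
    1 / (N : ℝ) ^ 3 + 1 / (2 * N * (N + 1)) + 1 / (2 * N) < qConst N ∧
      qConst N < 1 / (2 * N * (N - 1)) + 1 / (N : ℝ) - 1 / (2 * N + 1) := by
  have hN' : (2 : ℝ) ≤ N := by exact_mod_cast hN
  set f : ℕ → ℝ := fun j => (1 / (((j + N : ℕ) : ℝ)) ^ 3 +
    (N : ℝ) / ((((j + N : ℕ) : ℝ)) ^ 2 * (((j + N : ℕ) : ℝ) + 1))) with hf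
  have hq : qConst N = ∑' j, f j := rfl
  let G : ℝ → ℝ := fun x => 1 / (2 * x * (x - 1)) + N * (1 / (2 * x ^ 2) + 1 / (6 * x ^ 3))
  let L : ℝ → ℝ := fun x => (1 / (2 * x ^ 2) + 1 / (2 * x ^ 3))
    + N * (1 / (2 * x ^ 2) + 1 / (8 * x ^ 3))
  have hx : ∀ j : ℕ, (2 : ℝ) ≤ ((j + N : ℕ) : ℝ) := fun j => by
    exact_mod_cast (by omega : 2 ≤ j + N)
  have hf0 : ∀ j, 0 ≤ f j := fun j => by positivity
  have hU : ∀ n, ∑ j ∈ Finset.range n, f j ≤ G N - G ((n + N : ℕ) : ℝ) := by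
    intro n
    induction n with
    | zero => simp
    | succ n ih =>
      rw [Finset.sum_range_succ]
      have h1 := aux_u1 _ (hx n)
      have h2 := mul_le_mul_of_nonneg_left (aux_u2 _ (hx n)) (Nat.cast_nonneg (α := ℝ) N)
      have e : ((n + 1 + N : ℕ) : ℝ) = ((n + N : ℕ) : ℝ) + 1 := by push_cast; ring
      rw [mul_one_div] at h2
      rw [e]
      simp only [G, hf] at ih ⊢
      linarith
  have hL : ∀ n, L N - L ((n + N : ℕ) : ℝ) ≤ ∑ j ∈ Finset.range n, f j := by
    intro n
    induction n with
    | zero => simp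
    | succ n ih =>
      rw [Finset.sum_range_succ]
      have h1 := aux_l1 _ (hx n)
      have h2 := mul_le_mul_of_nonneg_left (aux_l2 _ (hx n)) (Nat.cast_nonneg (α := ℝ) N)
      have e : ((n + 1 + N : ℕ) : ℝ) = ((n + N : ℕ) : ℝ) + 1 := by push_cast; ring
      rw [mul_one_div] at h2
      rw [e]
      simp only [L, hf] at ih ⊢
      linarith
  have hU' : ∀ n, ∑ j ∈ Finset.range n, f j ≤ G N := by
    intro n
    have h := hU n
    have : 0 ≤ G ((n + N : ℕ) : ℝ) := by
      have h2 := hx n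
      have h3 : 0 ≤ ((n + N : ℕ) : ℝ) - 1 := by linarith
      simp only [G]
      positivity
    linarith
  have hs : Summable f := summable_of_sum_range_le hf0 hU'
  have hup : ∑' j, f j ≤ G N := Real.tsum_le_of_sum_range_le hf0 hU'
  have hlim : Tendsto (fun n : ℕ => L ((n + N : ℕ) : ℝ)) atTop (nhds 0) := by
    have h0 : Tendsto (fun n : ℕ => (((n + N : ℕ) : ℝ))⁻¹) atTop (nhds 0) :=
      tendsto_inv_atTop_zero.comp
        (tendsto_natCast_atTop_atTop.comp (tendsto_add_atTop_nat N))
    have h1 : Tendsto (fun n : ℕ => (1 / 2 * (((n + N : ℕ) : ℝ))⁻¹ ^ 2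
        + 1 / 2 * (((n + N : ℕ) : ℝ))⁻¹ ^ 3) + N * (1 / 2 * (((n + N : ℕ) : ℝ))⁻¹ ^ 2
        + 1 / 8 * (((n + N : ℕ) : ℝ))⁻¹ ^ 3)) atTop
        (nhds ((1 / 2 * (0 : ℝ) ^ 2 + 1 / 2 * (0 : ℝ) ^ 3) + (N : ℝ) * (1 / 2 * 0 ^ 2 + 1 / 8 * 0 ^ 3))) :=
      (((h0.pow 2).const_mul _).add ((h0.pow 3).const_mul _)).add
        ((((h0.pow 2).const_mul _).add ((h0.pow 3).const_mul _)).const_mul _)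
    convert h1 using 2
    · simp only [L]
      field_simp
    · norm_num
  have hlo : L N ≤ ∑' j, f j := by
    have h := le_of_tendsto_of_tendsto' (hlim.const_sub (L N)) hs.hasSum.tendsto_sum_nat hL
    simpa using h
  rw [hq]
  simp only [G] at hup
  simp only [L] at hlo
  clear hU hL hU' hlim hf hf0 L G
  generalize (N : ℝ) = x at *
  have hx0 : 0 < x := by linarith
  constructor
  · refine lt_of_lt_of_le ?_ hlo
    rw [← sub_pos]
    have : (1 / (2 * x ^ 2) + 1 / (2 * x ^ 3)
      + x * (1 / (2 * x ^ 2) + 1 / (8 * x ^ 3))) - (1 / x ^ 3 + 1 / (2 * x * (x + 1)) + 1 / (2 * x))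
      = (x ^ 2 + x - 4) / (8 * x ^ 3 * (x + 1)) := by
      field_simp
      ring
    rw [this]
    have : 0 < x ^ 2 + x - 4 := by nlinarith
    positivity
  · refine lt_of_le_of_lt hup ?_
    rw [← sub_pos]
    have : 1 / (2 * x * (x - 1)) + 1 / x - 1 / (2 * x + 1) - (1 / (2 * x * (x - 1))
      + x * (1 / (2 * x ^ 2) + 1 / (6 * x ^ 3)))
      = (x - 1) / (6 * x ^ 2 * (2 * x + 1)) := by
      rw [add_sub_assoc, add_sub_add_left_eq_sub]
      field_simp
      ring
    rw [this]
    have : 0 < x - 1 := by linarith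
    positivity
end

section
/- For every integer N ≥ 2, Σ_{i≥N} 1/i² ≥ 2/(√(4N²+1) − 1). -/
open MeasureTheory Set Filter

lemma zeta2_step (x : ℝ) (hx : 1 ≤ x) :
    2 / (Real.sqrt (4 * x ^ 2 + 1) - 1) - 2 / (Real.sqrt (4 * (x + 1) ^ 2 + 1) - 1) ≤ 1 / x ^ 2 := by
  have hs := Real.sq_sqrt (show (0:ℝ) ≤ 4 * x ^ 2 + 1 by positivity)
  have h1 : 2 * x ≤ Real.sqrt (4 * x ^ 2 + 1) := Real.le_sqrt_of_sq_le (by nlinarith)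
  have h2 : 2 * (x + 1) ≤ Real.sqrt (4 * (x + 1) ^ 2 + 1) := Real.le_sqrt_of_sq_le (by nlinarith)
  have h3 : Real.sqrt (4 * (x + 1) ^ 2 + 1) ≤ Real.sqrt (4 * x ^ 2 + 1) + 2 :=
    Real.sqrt_le_iff.2 ⟨by linarith, by nlinarith⟩
  set s := Real.sqrt (4 * x ^ 2 + 1)
  set t := Real.sqrt (4 * (x + 1) ^ 2 + 1)
  have h4 : 2 / (s + 1) ≤ 2 / (t - 1) :=
    div_le_div_of_nonneg_left (by norm_num) (by linarith) (by linarith)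
  have h5 : 1 / x ^ 2 = 2 / (s - 1) - 2 / (s + 1) := by
    have a : s - 1 ≠ 0 := by linarith
    have b : s + 1 ≠ 0 := by linarith
    have c : x ≠ 0 := by linarith
    field_simp
    nlinarith
  linarith

theorem zeta2_lower_bound (N : ℕ) (hN : 2 ≤ N) :
    (∑' j : ℕ, 1 / (((j + N : ℕ) : ℝ)) ^ 2) ≥
      2 / (Real.sqrt (4 * (N : ℝ) ^ 2 + 1) - 1) := by
  have hN' : (2:ℝ) ≤ N := by exact_mod_cast hN
  have hsum : Summable (fun j : ℕ => 1 / (((j + N : ℕ) : ℝ)) ^ 2) :=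
    (summable_nat_add_iff (f := fun n : ℕ => 1 / (n : ℝ) ^ 2) N).2
      (Real.summable_one_div_nat_pow.2 (by norm_num))
  have hfin : ∀ k : ℕ, 2 / (Real.sqrt (4 * (N : ℝ) ^ 2 + 1) - 1)
      - 2 / (Real.sqrt (4 * ((k : ℝ) + N) ^ 2 + 1) - 1)
      ≤ ∑ j ∈ Finset.range k, 1 / (((j + N : ℕ) : ℝ)) ^ 2 := by
    intro k
    induction k with
    | zero => simp
    | succ k ih =>
      rw [Finset.sum_range_succ]
      have hk : (0:ℝ) ≤ k := Nat.cast_nonneg k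
      have h := zeta2_step ((k : ℝ) + N) (by linarith)
      have e : ((k + 1 : ℕ) : ℝ) + N = (k : ℝ) + N + 1 := by push_cast; ring
      rw [e]
      push_cast at ih ⊢
      linarith
  have hlim : Tendsto (fun k : ℕ => 2 / (Real.sqrt (4 * ((k : ℝ) + N) ^ 2 + 1) - 1)) atTop
      (nhds 0) := by
    apply Tendsto.const_div_atTop
    refine tendsto_atTop_mono (fun k : ℕ => ?_) (tendsto_natCast_atTop_atTop (R := ℝ))
    have hk : (0:ℝ) ≤ k := Nat.cast_nonneg k
    have h1 : 2 * ((k : ℝ) + N) ≤ Real.sqrt (4 * ((k : ℝ) + N) ^ 2 + 1) :=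
      Real.le_sqrt_of_sq_le (by nlinarith)
    linarith
  have hl := hlim.const_sub (2 / (Real.sqrt (4 * (N : ℝ) ^ 2 + 1) - 1))
  rw [sub_zero] at hl
  exact le_of_tendsto_of_tendsto' hl hsum.hasSum.tendsto_sum_nat hfin
end

section
/- For every integer N ≥ 2, Σ_{i≥N} 1/i³ < 1/(2N(√(N²+1) − 1)). -/
open MeasureTheory Set Filter

noncomputable def gAux (x : ℝ) : ℝ := (8 * x ^ 4 + 8 * x ^ 3 + 4 * x ^ 2 - 1) / (16 * x ^ 6)

lemma gAux_step (y : ℝ) (hy : 0 ≤ y) :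
    1 / (y + 2) ^ 3 ≤ gAux (y + 2) - gAux (y + 2 + 1) := by
  unfold gAux
  rw [div_sub_div _ _ (by positivity) (by positivity), div_le_div_iff₀ (by positivity) (by positivity),
    ← sub_nonneg]
  ring_nf
  positivity

lemma gAux_nonneg (y : ℝ) (hy : 2 ≤ y) : 0 ≤ gAux y := by
  unfold gAux
  have h : 0 ≤ 4 * y ^ 2 - 1 := by nlinarith
  have h4 : 0 ≤ y := by linarith
  apply div_nonneg _ (by positivity)
  have : 0 ≤ 8 * y ^ 4 + 8 * y ^ 3 := by positivity
  linarith

lemma gAux_sum (x : ℝ) (hx : 2 ≤ x) (n : ℕ) :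
    ∑ j ∈ Finset.range n, 1 / ((j : ℝ) + x) ^ 3 ≤ gAux x - gAux (n + x) := by
  induction n with
  | zero => simp
  | succ k ih =>
    rw [Finset.sum_range_succ]
    have hk : (0 : ℝ) ≤ k := k.cast_nonneg
    have h := gAux_step (k + x - 2) (by linarith)
    rw [show (k : ℝ) + x - 2 + 2 = k + x by ring] at h
    rw [show ((k + 1 : ℕ) : ℝ) + x = k + x + 1 by push_cast; ring]
    linarith

theorem zeta3_upper_bound (N : ℕ) (hN : 2 ≤ N) :
    (∑' j : ℕ, 1 / (((j + N : ℕ) : ℝ)) ^ 3) <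
      1 / (2 * (N : ℝ) * (Real.sqrt ((N : ℝ) ^ 2 + 1) - 1)) := by
  have hx : (2 : ℝ) ≤ N := by exact_mod_cast hN
  have h1 : (∑' j : ℕ, 1 / (((j + N : ℕ) : ℝ)) ^ 3) ≤ gAux N := by
    apply Real.tsum_le_of_sum_range_le
    · intro n; positivity
    · intro n
      have h := gAux_sum N hx n
      have h2 := gAux_nonneg (n + N) (by have : (0 : ℝ) ≤ n := n.cast_nonneg
                                         linarith)
      push_cast
      linarith
  refine lt_of_le_of_lt h1 ?_
  generalize (N : ℝ) = x at hx
  have hx0 : 0 < x := by linarith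
  have hs : x + 1 / (2 * x) - 1 / (8 * x ^ 3) < Real.sqrt (x ^ 2 + 1) := by
    apply Real.lt_sqrt_of_sq_lt
    have : x ^ 2 + 1 - (x + 1 / (2 * x) - 1 / (8 * x ^ 3)) ^ 2 = (8 * x ^ 2 - 1) / (64 * x ^ 6) := by
      field_simp
      ring
    have h3 : 0 < (8 * x ^ 2 - 1) / (64 * x ^ 6) := div_pos (by nlinarith) (by positivity)
    linarith
  have hq : Real.sqrt (x ^ 2 + 1) ^ 2 = x ^ 2 + 1 := Real.sq_sqrt (by positivity)
  have h1s : 1 < Real.sqrt (x ^ 2 + 1) := Real.lt_sqrt_of_sq_lt (by nlinarith)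
  generalize Real.sqrt (x ^ 2 + 1) = s at *
  have e : 1 / (2 * x * (s - 1)) = (s + 1) / (2 * x ^ 3) := by
    rw [div_eq_div_iff (by have : s - 1 ≠ 0 := by linarith
                           positivity) (by positivity)]
    linear_combination (-2 * x) * hq
  have e2 : gAux x = (x + 1 / (2 * x) - 1 / (8 * x ^ 3) + 1) / (2 * x ^ 3) := by
    unfold gAux
    field_simp
    ring
  rw [e, e2]
  gcongr
end

section
/- For every integer N ≥ 2, Σ_{i≥N} 1/i³ > 1/N³ + 1/(2(N² + N + 1/2)). -/
open MeasureTheory Set Filter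

theorem zeta3_lower_bound (N : ℕ) (hN : 2 ≤ N) :
    (∑' j : ℕ, 1 / (((j + N : ℕ) : ℝ)) ^ 3) >
      1 / (N : ℝ) ^ 3 + 1 / (2 * ((N : ℝ) ^ 2 + (N : ℝ) + 1 / 2)) := by
  have hs : Summable (fun j : ℕ => 1 / (((j + N : ℕ) : ℝ)) ^ 3) :=
    (summable_nat_add_iff (f := fun j : ℕ => 1 / (j : ℝ) ^ 3) N).2
      (Real.summable_one_div_nat_pow.2 (by norm_num))
  have hs1 := (summable_nat_add_iff 1).2 hs
  rw [hs.tsum_eq_zero_add]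
  set G : ℕ → ℝ := fun j => 1 / (2 * (((j : ℝ) + N) ^ 2 + ((j : ℝ) + N) + 1 / 2)) with hG
  have key : ∀ j : ℕ, 0 ≤ G j - G (j + 1) ∧
      G j - G (j + 1) < 1 / (((j + 1 + N : ℕ) : ℝ)) ^ 3 := by
    intro j
    have hx : (0 : ℝ) ≤ (j : ℝ) + N := by positivity
    simp only [hG]
    push_cast
    have e : (j : ℝ) + 1 + N = ((j : ℝ) + N) + 1 := by ring
    rw [e]
    generalize (j : ℝ) + N = x at hx
    have e2 : 1 / (2 * (x ^ 2 + x + 1 / 2)) - 1 / (2 * ((x + 1) ^ 2 + (x + 1) + 1 / 2))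
        = 4 * (x + 1) / (4 * (x + 1) ^ 4 + 1) := by
      have h1 : 2 * (x ^ 2 + x + 1 / 2) ≠ 0 := by positivity
      have h2 : 2 * ((x + 1) ^ 2 + (x + 1) + 1 / 2) ≠ 0 := by positivity
      have h3 : 4 * (x + 1) ^ 4 + 1 ≠ 0 := by positivity
      rw [div_sub_div _ _ h1 h2, div_eq_div_iff (mul_ne_zero h1 h2) h3]
      ring
    rw [e2]
    refine ⟨by positivity, ?_⟩
    rw [div_lt_div_iff₀ (by positivity) (by positivity)]
    nlinarith
  have hlim : Tendsto G atTop (nhds 0) := by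
    refine squeeze_zero (fun j => by simp only [hG]; positivity) (fun j => ?_)
      (tendsto_one_div_add_atTop_nhds_zero_nat (𝕜 := ℝ))
    simp only [hG]
    have : (0 : ℝ) ≤ (j : ℝ) := by positivity
    have : (0 : ℝ) ≤ (N : ℝ) := by positivity
    apply one_div_le_one_div_of_le (by positivity)
    nlinarith [sq_nonneg ((j : ℝ) + N)]
  have hsum : HasSum (fun j => G j - G (j + 1)) (G 0) := by
    rw [hasSum_iff_tendsto_nat_of_nonneg (fun j => (key j).1)]
    simp only [Finset.sum_range_sub']
    simpa using hlim.const_sub (G 0)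
  have hlt := Summable.tsum_lt_tsum (i := 0) (fun j => (key j).2.le) (key 0).2 hsum.summable hs1
  rw [hsum.tsum_eq] at hlt
  simp only [hG, Nat.cast_zero, zero_add] at hlt ⊢
  linarith
end

section
/- Fix an integer N ≥ 2. For every x ∈ [0,1], Σ_{i≥N} [ (i+1−N)/((x+i)³(x+i+1)) + N·(x+N−1)/((x+i)³(x+i−1)) ] ≤ Σ_{i≥N} (1/i³ + N/(i²(i+1))). -/
open MeasureTheory Set Filter

theorem aux_second (x n i : ℝ) (hx : 0 ≤ x) (hn : 2 ≤ n) (hi : n ≤ i) :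
    n * (x + n - 1) / ((x + i) ^ 3 * (x + i - 1)) ≤ n / (x + i) ^ 3 := by
  have h1 : 0 < x + i := by linarith
  have h2 : 0 < x + i - 1 := by linarith
  rw [div_le_div_iff₀ (by positivity) (by positivity)]
  have : n * (x + n - 1) ≤ n * (x + i - 1) :=
    mul_le_mul_of_nonneg_left (by linarith) (by linarith)
  have h3 : 0 ≤ (x + i) ^ 3 := by positivity
  nlinarith [mul_le_mul_of_nonneg_right this h3]

theorem aux_term (x n i : ℝ) (hx : 0 ≤ x) (hn : 2 ≤ n) (hi : n ≤ i) :
    (i + 1 - n) / ((x + i) ^ 3 * (x + i + 1)) +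
      n * (x + n - 1) / ((x + i) ^ 3 * (x + i - 1)) ≤ 1 / i ^ 3 + n / (i ^ 2 * (i + 1)) := by
  have hi0 : 0 < i := by linarith
  have h1 : 0 < x + i := by linarith
  have hn0 : 0 ≤ n := by linarith
  have ha : (i + 1 - n) / ((x + i) ^ 3 * (x + i + 1)) ≤
      (x + i + 1 - n) / ((x + i) ^ 3 * (x + i + 1)) := by
    apply div_le_div_of_nonneg_right (by linarith) (by positivity)
  have hb := aux_second x n i hx hn hi
  have hc : (x + i + 1 - n) / ((x + i) ^ 3 * (x + i + 1)) + n / (x + i) ^ 3 =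
      1 / (x + i) ^ 3 + n / ((x + i) ^ 2 * (x + i + 1)) := by
    have h1' : x + i ≠ 0 := h1.ne'
    have h2' : x + i + 1 ≠ 0 := by positivity
    field_simp
    ring
  have hd : 1 / (x + i) ^ 3 ≤ 1 / i ^ 3 := by
    gcongr; linarith
  have he : n / ((x + i) ^ 2 * (x + i + 1)) ≤ n / (i ^ 2 * (i + 1)) := by
    gcongr <;> linarith
  linarith

theorem aux_summable (N : ℕ) (hN : 2 ≤ N) : Summable (fun j : ℕ =>
    (1 / (((j + N : ℕ) : ℝ)) ^ 3 +
    (N : ℝ) / ((((j + N : ℕ) : ℝ)) ^ 2 * (((j + N : ℕ) : ℝ) + 1)))) := by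
  have h0 : Summable (fun i : ℕ => 1 / (i : ℝ) ^ 3) :=
    Real.summable_one_div_nat_pow.mpr (by norm_num)
  have h1 : Summable (fun j : ℕ => 1 / ((j + N : ℕ) : ℝ) ^ 3) :=
    (summable_nat_add_iff (f := fun i : ℕ => 1 / (i : ℝ) ^ 3) N).mpr h0
  refine h1.add (Summable.of_nonneg_of_le (fun j => by positivity) (fun j => ?_)
    (h1.mul_left (N : ℝ)))
  have : 0 < ((j + N : ℕ) : ℝ) := by
    have : 0 < j + N := by omega
    exact_mod_cast this
  rw [mul_one_div]
  gcongr
  nlinarith [sq_nonneg ((j + N : ℕ) : ℝ)]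

theorem sum_bound_by_qConst (N : ℕ) (hN : 2 ≤ N) (x : ℝ) (hx : x ∈ Icc (0 : ℝ) 1) :
    (∑' j : ℕ,
        ((((j + N : ℕ) : ℝ) + 1 - N) / ((x + ((j + N : ℕ) : ℝ)) ^ 3 * (x + ((j + N : ℕ) : ℝ) + 1)) +
          (N : ℝ) * (x + N - 1) / ((x + ((j + N : ℕ) : ℝ)) ^ 3 * (x + ((j + N : ℕ) : ℝ) - 1)))) ≤
      qConst N := by
  have hn : (2 : ℝ) ≤ N := by exact_mod_cast hN
  have hi : ∀ j : ℕ, (N : ℝ) ≤ ((j + N : ℕ) : ℝ) := fun j => by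
    exact_mod_cast Nat.le_add_left N j
  have hs := aux_summable N hN
  have hle := fun j : ℕ => aux_term x N ((j + N : ℕ) : ℝ) hx.1 hn (hi j)
  unfold qConst
  refine Summable.tsum_le_tsum hle (Summable.of_nonneg_of_le (fun j => ?_) hle hs) hs
  have h0 := hx.1
  have hj := hi j
  generalize ((j + N : ℕ) : ℝ) = i at hj
  have h1 : 0 < x + i := by linarith
  have h2 : 0 < x + i - 1 := by linarith
  have h3 : 0 < x + N - 1 := by linarith
  have h4 : 0 < i + 1 - N := by linarith
  positivity
end
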